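/- Let m ≥ 0 and let (Z_i)_{i≥1} be a strictly stationary, m-dependent sequence of ℝᵖ-valued random vectors with E[Z_1] = 0 and E[‖Z_1‖³] < ∞. Define Ω := E[Z_1 Z_1ᵀ] + Σ_{k=1}^m (E[Z_1 Z_{1+k}ᵀ] + E[Z_{1+k} Z_1ᵀ]). Then n^{−1/2} Σ_{i=1}^n Z_i converges in distribution to the p-dimensional normal distribution N_p(0, Ω); equivalently, for every a ∈ ℝᵖ, aᵀ(n^{−1/2} Σ_{i=1}^n Z_i) converges in distribution to N(0, aᵀΩa). -/

import Mathlib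

open MeasureTheory ProbabilityTheory Filter Finset

/-- Scalar stationary m-dependent square integrable centered sequences (indexed from 0). -/
structure MDepSeq {Ω : Type*} [MeasurableSpace Ω] (μ : Measure Ω) (m : ℕ) (X : ℕ → Ω → ℝ) :
    Prop where
  meas : ∀ i, Measurable (X i)
  stat : ∀ k j : ℕ, Measure.map (fun ω => fun i : Fin k => X i.1 ω) μ
        = Measure.map (fun ω => fun i : Fin k => X (i.1 + j) ω) μ
  dep : ∀ k : ℕ, Indep (⨆ i : Fin k, MeasurableSpace.comap (X i.1) inferInstance)
        (⨆ i : ℕ, MeasurableSpace.comap (X (k + m + i)) inferInstance) μ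
  mean : ∫ ω, X 0 ω ∂μ = 0
  sq : MemLp (X 0) 2 μ

namespace MDepSeq

variable {Ω : Type*} [MeasurableSpace Ω] {μ : Measure Ω} [IsProbabilityMeasure μ] {m : ℕ}
  {X : ℕ → Ω → ℝ}

lemma map_eq (h : MDepSeq μ m X) (k j : ℕ) (F : (Fin k → ℝ) → ℝ) (hF : Measurable F) :
    Measure.map (fun ω => F (fun i : Fin k => X (i.1 + j) ω)) μ
      = Measure.map (fun ω => F (fun i : Fin k => X i.1 ω)) μ := by
  have h1 : Measurable (fun ω => fun i : Fin k => X i.1 ω) :=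
    measurable_pi_lambda _ fun i => h.meas _
  have h2 : Measurable (fun ω => fun i : Fin k => X (i.1 + j) ω) :=
    measurable_pi_lambda _ fun i => h.meas _
  have e1 := Measure.map_map (μ := μ) hF h1
  have e2 := Measure.map_map (μ := μ) hF h2
  rw [← h.stat k j, e1] at e2
  exact e2.symm

lemma ident (h : MDepSeq μ m X) (k j : ℕ) (F : (Fin k → ℝ) → ℝ) (hF : Measurable F) :
    IdentDistrib (fun ω => F (fun i : Fin k => X (i.1 + j) ω))
      (fun ω => F (fun i : Fin k => X i.1 ω)) μ μ where
  aemeasurable_fst := (hF.comp (measurable_pi_lambda _ fun i => h.meas _)).aemeasurable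
  aemeasurable_snd := (hF.comp (measurable_pi_lambda _ fun i => h.meas _)).aemeasurable
  map_eq := h.map_eq k j F hF

lemma ident_one (h : MDepSeq μ m X) (j : ℕ) : IdentDistrib (X j) (X 0) μ μ := by
  have := h.ident 1 j (fun x => x 0) (measurable_pi_apply 0)
  simpa using this

lemma memLp (h : MDepSeq μ m X) (j : ℕ) : MemLp (X j) 2 μ := (h.ident_one j).memLp_iff.2 h.sq

lemma mean' (h : MDepSeq μ m X) (j : ℕ) : ∫ ω, X j ω ∂μ = 0 := by
  rw [(h.ident_one j).integral_eq, h.mean]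

lemma int_mul (h : MDepSeq μ m X) (i j : ℕ) : Integrable (fun ω => X i ω * X j ω) μ :=
  (h.memLp i).integrable_mul (h.memLp j)

lemma cov_shift (h : MDepSeq μ m X) (i k : ℕ) :
    ∫ ω, X i ω * X (i + k) ω ∂μ = ∫ ω, X 0 ω * X k ω ∂μ := by
  have := (h.ident (k + 1) i (fun x => x 0 * x (Fin.last k)) (by fun_prop)).integral_eq
  simpa [add_comm] using this

lemma indep_sum (h : MDepSeq μ m X) (k : ℕ) (A B : Finset ℕ) (hA : ∀ i ∈ A, i < k)
    (hB : ∀ i ∈ B, k + m ≤ i) :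
    IndepFun (fun ω => ∑ i ∈ A, X i ω) (fun ω => ∑ i ∈ B, X i ω) μ := by
  rw [IndepFun_iff_Indep]
  refine indep_of_indep_of_le (h.dep k) ?_ ?_
  · rw [← measurable_iff_comap_le]
    refine Finset.measurable_fun_sum _ fun i hi => ?_
    rw [measurable_iff_comap_le]
    exact le_iSup (fun i : Fin k => MeasurableSpace.comap (X i.1) inferInstance) ⟨i, hA i hi⟩
  · rw [← measurable_iff_comap_le]
    refine Finset.measurable_fun_sum _ fun i hi => ?_
    rw [measurable_iff_comap_le]
    have := le_iSup (fun i : ℕ => MeasurableSpace.comap (X (k + m + i)) inferInstance) (i - (k + m))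
    rwa [Nat.add_sub_cancel' (hB i hi)] at this

lemma cov_zero (h : MDepSeq μ m X) (i j : ℕ) (hij : i + m < j) :
    ∫ ω, X i ω * X j ω ∂μ = 0 := by
  have := h.indep_sum (i + 1) {i} {j} (by simp) (by simp; omega)
  simp only [sum_singleton] at this
  rw [this.integral_fun_mul_eq_mul_integral (h.meas i).aestronglyMeasurable
    (h.meas j).aestronglyMeasurable, h.mean' i, zero_mul]

lemma cov_zero' (h : MDepSeq μ m X) (i j : ℕ) (hij : i + m < j ∨ j + m < i) :
    ∫ ω, X i ω * X j ω ∂μ = 0 := by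
  rcases hij with hij | hij
  · exact h.cov_zero i j hij
  · simp_rw [mul_comm (X i _)]
    exact h.cov_zero j i hij

lemma sq_eq (h : MDepSeq μ m X) (i : ℕ) : ∫ ω, X i ω ^ 2 ∂μ = ∫ ω, X 0 ω ^ 2 ∂μ := by
  have := h.cov_shift i 0
  simpa [pow_two] using this

lemma cov_le (h : MDepSeq μ m X) (i j : ℕ) :
    ∫ ω, X i ω * X j ω ∂μ ≤ ∫ ω, X 0 ω ^ 2 ∂μ := by
  have h1 : ∫ ω, X i ω * X j ω ∂μ ≤ ∫ ω, (X i ω ^ 2 + X j ω ^ 2) / 2 ∂μ := by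
    refine integral_mono (h.int_mul i j)
      (((h.memLp i).integrable_sq.add (h.memLp j).integrable_sq).div_const 2) fun ω => ?_
    have := sq_nonneg (X i ω - X j ω)
    simp only
    nlinarith
  rw [integral_div, integral_add (h.memLp i).integrable_sq (h.memLp j).integrable_sq, h.sq_eq i,
    h.sq_eq j] at h1
  linarith

lemma sum_sq (h : MDepSeq μ m X) (A : Finset ℕ) :
    ∫ ω, (∑ i ∈ A, X i ω) ^ 2 ∂μ = ∑ i ∈ A, ∑ j ∈ A, ∫ ω, X i ω * X j ω ∂μ := by
  simp_rw [pow_two, Finset.sum_mul_sum]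
  rw [integral_finsetSum _ fun i _ => integrable_finsetSum _ fun j _ => h.int_mul i j]
  refine Finset.sum_congr rfl fun i _ => ?_
  rw [integral_finsetSum _ fun j _ => h.int_mul i j]

lemma sum_sq_le (h : MDepSeq μ m X) (A : Finset ℕ) :
    ∫ ω, (∑ i ∈ A, X i ω) ^ 2 ∂μ ≤ A.card * ((2 * m + 1) * ∫ ω, X 0 ω ^ 2 ∂μ) := by
  rw [h.sum_sq, ← nsmul_eq_mul]
  refine Finset.sum_le_card_nsmul _ _ _ fun i hi => ?_
  have h0 : 0 ≤ ∫ ω, X 0 ω ^ 2 ∂μ := integral_nonneg fun ω => sq_nonneg _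
  have h1 : ∑ j ∈ A, ∫ ω, X i ω * X j ω ∂μ
      = ∑ j ∈ A.filter (fun j => j ∈ Finset.Icc (i - m) (i + m)), ∫ ω, X i ω * X j ω ∂μ := by
    symm
    refine Finset.sum_filter_of_ne fun j hj hne => ?_
    by_contra hcon
    refine hne (h.cov_zero' i j ?_)
    simp only [Finset.mem_Icc] at hcon
    omega
  rw [h1]
  refine (Finset.sum_le_card_nsmul _ _ _ fun j _ => h.cov_le i j).trans ?_
  rw [nsmul_eq_mul]
  refine mul_le_mul_of_nonneg_right ?_ h0
  have h2 : (A.filter (fun j => j ∈ Finset.Icc (i - m) (i + m))).card ≤ 2 * m + 1 := by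
    refine (Finset.card_le_card (t := Finset.Icc (i - m) (i + m)) ?_).trans ?_
    · intro j hj
      exact (Finset.mem_filter.1 hj).2
    · simp only [Nat.card_Icc]
      omega
  exact_mod_cast h2

/-- partial sum second moment -/
noncomputable def V (μ : Measure Ω) (X : ℕ → Ω → ℝ) (q : ℕ) : ℝ :=
  ∫ ω, (∑ i ∈ Finset.range q, X i ω) ^ 2 ∂μ

/-- long run variance -/
noncomputable def lrv (μ : Measure Ω) (X : ℕ → Ω → ℝ) (m : ℕ) : ℝ :=
  (∫ ω, X 0 ω * X 0 ω ∂μ) + 2 * ∑ k ∈ Finset.range m, ∫ ω, X 0 ω * X (k + 1) ω ∂μ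

lemma V_succ (h : MDepSeq μ m X) (q : ℕ) (hq : m ≤ q) : V μ X (q + 1) = V μ X q + lrv μ X m := by
  unfold V lrv
  rw [h.sum_sq, h.sum_sq]
  simp_rw [Finset.sum_range_succ, Finset.sum_add_distrib]
  have e1 : ∑ i ∈ range q, ∫ ω, X q ω * X i ω ∂μ = ∑ i ∈ range q, ∫ ω, X i ω * X q ω ∂μ := by
    simp_rw [mul_comm]
  have e2 : ∑ i ∈ range q, ∫ ω, X i ω * X q ω ∂μ
      = ∑ k ∈ Finset.range m, ∫ ω, X 0 ω * X (k + 1) ω ∂μ := by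
    rw [← Finset.sum_range_reflect]
    have e3 : ∑ k ∈ Finset.range m, ∫ ω, X 0 ω * X (k + 1) ω ∂μ
        = ∑ k ∈ Finset.range q, ∫ ω, X 0 ω * X (k + 1) ω ∂μ := by
      refine Finset.sum_subset (by simpa using hq) fun k _ hk => ?_
      exact h.cov_zero _ _ (by simp at hk; omega)
    rw [e3]
    refine Finset.sum_congr rfl fun k hk => ?_
    rw [← h.cov_shift (q - 1 - k) (k + 1)]
    simp only [Finset.mem_range] at hk
    congr! 4
    omega
  have e4 := h.cov_shift q 0
  simp only [add_zero] at e4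
  rw [e1, e2, e4]
  ring

lemma V_eq (h : MDepSeq μ m X) (r : ℕ) : V μ X (m + r) = V μ X m + r * lrv μ X m := by
  induction r with
  | zero => simp
  | succ r ih => rw [← add_assoc, h.V_succ _ (by omega), ih]; push_cast; ring

lemma V_tendsto (h : MDepSeq μ m X) :
    Tendsto (fun q : ℕ => V μ X q / (q + m : ℕ)) atTop (nhds (lrv μ X m)) := by
  rw [← tendsto_add_atTop_iff_nat m]
  have e : ∀ r : ℕ, V μ X (r + m) / ((r + m + m : ℕ) : ℝ)
      = V μ X m / ((r + (m + m) : ℕ) : ℝ) + (r / (r + (2 * m : ℝ))) * lrv μ X m := by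
    intro r
    rw [add_comm r m, h.V_eq r]
    push_cast
    rw [add_div]
    congr 1
    · ring_nf
    · ring_nf
  simp_rw [e]
  have t1 : Tendsto (fun r : ℕ => V μ X m / ((r + (m + m) : ℕ) : ℝ)) atTop (nhds 0) :=
    (tendsto_add_atTop_iff_nat (f := fun r : ℕ => V μ X m / (r : ℝ)) (m + m)).2
      (tendsto_const_div_atTop_nhds_zero_nat _)
  have t2 := tendsto_natCast_div_add_atTop (𝕜 := ℝ) (2 * m : ℝ)
  simpa using t1.add (t2.mul_const (lrv μ X m))

lemma lrv_nonneg (h : MDepSeq μ m X) : 0 ≤ lrv μ X m :=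
  ge_of_tendsto' h.V_tendsto fun q =>
    div_nonneg (integral_nonneg fun ω => sq_nonneg _) (Nat.cast_nonneg _)


lemma charFun_sub_le {A B : Ω → ℝ} (hA : Measurable A) (hB : Measurable B)
    (hAB : MemLp (fun ω => A ω - B ω) 2 μ) (t : ℝ) :
    ‖charFun (μ.map A) t - charFun (μ.map B) t‖ ≤ |t| * √(∫ ω, (A ω - B ω) ^ 2 ∂μ) := by
  have key : ∀ C : Ω → ℝ, Measurable C →
      charFun (μ.map C) t = ∫ ω, Complex.exp (t * C ω * Complex.I) ∂μ := by
    intro C hC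
    rw [charFun_apply_real, integral_map hC.aemeasurable]
    exact (by fun_prop : Continuous fun x : ℝ =>
      Complex.exp (t * x * Complex.I)).aestronglyMeasurable
  have hint : ∀ C : Ω → ℝ, Measurable C →
      Integrable (fun ω => Complex.exp (t * C ω * Complex.I)) μ := by
    intro C hC
    refine Integrable.of_bound (C := 1) (by fun_prop) (ae_of_all _ fun ω => ?_)
    rw [← Complex.ofReal_mul, Complex.norm_exp_ofReal_mul_I]
  rw [key A hA, key B hB, ← integral_sub (hint A hA) (hint B hB)]
  have hpt : ∀ ω, ‖Complex.exp (t * A ω * Complex.I) - Complex.exp (t * B ω * Complex.I)‖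
      ≤ |t| * |A ω - B ω| := by
    intro ω
    have e : Complex.exp (t * A ω * Complex.I) - Complex.exp (t * B ω * Complex.I)
        = Complex.exp ((t * B ω : ℝ) * Complex.I)
          * (Complex.exp (Complex.I * (t * (A ω - B ω) : ℝ)) - 1) := by
      rw [mul_sub, ← Complex.exp_add, mul_one]
      push_cast
      ring_nf
    rw [e, norm_mul, Complex.norm_exp_ofReal_mul_I, one_mul, ← abs_mul]
    exact Real.norm_exp_I_mul_ofReal_sub_one_le
  have hi1 : Integrable (fun ω => |A ω - B ω|) μ := (hAB.integrable (by norm_num)).abs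
  refine (norm_integral_le_of_norm_le (hi1.const_mul |t|) (ae_of_all _ hpt)).trans ?_
  rw [integral_const_mul]
  refine mul_le_mul_of_nonneg_left ?_ (abs_nonneg t)
  refine Real.le_sqrt_of_sq_le ?_
  have hv := variance_nonneg (fun ω => |A ω - B ω|) μ
  have habs : MemLp (fun ω => |A ω - B ω|) 2 μ := hAB.abs
  rw [variance_eq_sub habs] at hv
  simp only [Pi.pow_apply, sq_abs] at hv
  linarith

lemma charFun_pow_tendsto {U : Ω → ℝ} (hU : Measurable U) (hL : MemLp U 2 μ)
    (h0 : ∫ ω, U ω ∂μ = 0) (L : ℕ) (hLpos : 0 < L) (t : ℝ) :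
    Tendsto (fun n : ℕ => charFun (μ.map U) ((√n)⁻¹ * t) ^ (n / L)) atTop
      (nhds (Complex.exp ((-((∫ ω, U ω ^ 2 ∂μ) / L * t ^ 2 / 2) : ℝ)))) := by
  have : IsProbabilityMeasure (μ.map U) := Measure.isProbabilityMeasure_map hU.aemeasurable
  set w := ∫ ω, U ω ^ 2 ∂μ with hw
  have hid : MemLp id 2 (μ.map U) := by
    rw [memLp_map_measure_iff (by fun_prop) hU.aemeasurable]
    exact hL
  have taylor : (fun s : ℝ => charFun (μ.map U) s - (1 - w * s ^ 2 / 2)) =o[nhds 0]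
      fun s : ℝ => s ^ 2 := by
    have := taylor_isLittleO_univ (f := charFun (μ.map U)) (x₀ := 0) (n := 2)
      (contDiff_charFun hid)
    simp only [sub_zero] at this
    refine this.congr_left fun s => ?_
    rw [taylorWithinEval_charFun_two_zero hU.aemeasurable hid]
    have h0' : μ[U] = 0 := h0
    have hw' : μ[U ^ 2] = w := rfl
    rw [h0', hw']
    simp
  have hs : Tendsto (fun n : ℕ => (√n)⁻¹ * t) atTop (nhds 0) := by
    rw [← zero_mul t]
    exact .mul_const t (tendsto_inv_atTop_zero.comp <| Real.tendsto_sqrt_atTop.comp <|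
      tendsto_natCast_atTop_atTop)
  have h1 := taylor.comp_tendsto hs
  have hng : Tendsto (fun n : ℕ => (n : ℂ) * (charFun (μ.map U) ((√n)⁻¹ * t) - 1)) atTop
      (nhds (-(w * t ^ 2 / 2 : ℂ))) := by
    have h2 : (fun n : ℕ => charFun (μ.map U) ((√n)⁻¹ * t) - (1 - w * ((√n)⁻¹ * t : ℝ) ^ 2 / 2))
        =o[atTop] fun n : ℕ => ((n : ℂ))⁻¹ := by
      refine Asymptotics.IsLittleO.trans_isBigO h1 ?_
      refine Asymptotics.IsBigO.of_bound (t ^ 2) (Eventually.of_forall fun n => ?_)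
      simp only [Function.comp, mul_pow, inv_pow, Real.sq_sqrt (Nat.cast_nonneg n)]
      simp [mul_comm]
    have h3 := h2.tendsto_inv_smul_nhds_zero
    have h4 := h3.add_const (-(w * t ^ 2 / 2 : ℂ))
    rw [zero_add] at h4
    refine h4.congr' ?_
    filter_upwards [eventually_gt_atTop 0] with n hn
    have hn' : (n : ℂ) ≠ 0 := by exact_mod_cast hn.ne'
    have e : (((√n)⁻¹ * t : ℝ) : ℂ) ^ 2 = (n : ℂ)⁻¹ * t ^ 2 := by
      rw [← Complex.ofReal_pow, mul_pow, inv_pow, Real.sq_sqrt (Nat.cast_nonneg n)]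
      push_cast
      ring
    rw [e, inv_inv, smul_eq_mul]
    field_simp
    ring
  have hlog := Complex.tendsto_nat_mul_log_one_add_of_tendsto hng
  simp only [add_sub_cancel] at hlog
  have hfrac : Tendsto (fun n : ℕ => ((n / L : ℕ) : ℝ) / n) atTop (nhds (L : ℝ)⁻¹) := by
    have := (tendsto_nat_floor_mul_div_atTop (R := ℝ) (a := (L : ℝ)⁻¹) (by positivity)).comp
      tendsto_natCast_atTop_atTop
    refine this.congr fun n => ?_
    simp only [Function.comp]
    rw [inv_mul_eq_div, Nat.floor_div_natCast, Nat.floor_natCast]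
  have hfrac' : Tendsto (fun n : ℕ => (((n / L : ℕ) : ℂ) / n)) atTop (nhds ((L : ℂ)⁻¹)) := by
    have := (Complex.continuous_ofReal.tendsto _).comp hfrac
    simpa [Function.comp_def] using this
  have hexp := (Complex.continuous_exp.tendsto _).comp (hfrac'.mul hlog)
  have hne : ∀ᶠ n : ℕ in atTop, charFun (μ.map U) ((√n)⁻¹ * t) ≠ 0 := by
    have hc := ((continuous_charFun (μ := μ.map U)).tendsto 0).comp hs
    refine hc.eventually_ne ?_
    simp
  have hlim : (L : ℂ)⁻¹ * -(w * t ^ 2 / 2 : ℂ) = ((-(w / L * t ^ 2 / 2) : ℝ) : ℂ) := by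
    push_cast
    ring
  rw [← hlim]
  refine hexp.congr' ?_
  filter_upwards [hne, eventually_gt_atTop 0] with n hn hn0
  have hn' : (n : ℂ) ≠ 0 := by exact_mod_cast hn0.ne'
  simp only [Function.comp]
  rw [← mul_assoc, div_mul_cancel₀ _ hn', Complex.exp_nat_mul, Complex.exp_log hn]

/-- Index set of the big blocks. -/
def blk (q m N : ℕ) : Finset ℕ :=
  (Finset.range N).biUnion fun j => Finset.Ico (j * (q + m)) (j * (q + m) + q)

lemma blk_succ (q m N : ℕ) :
    blk q m (N + 1) = blk q m N ∪ Finset.Ico (N * (q + m)) (N * (q + m) + q) := by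
  unfold blk
  rw [Finset.range_add_one, Finset.biUnion_insert, Finset.union_comm]

lemma blk_lt (q m N i : ℕ) (hi : i ∈ blk q m N) : i + m < N * (q + m) := by
  simp only [blk, Finset.mem_biUnion, Finset.mem_range, Finset.mem_Ico] at hi
  obtain ⟨j, hj, h1, h2⟩ := hi
  have : (j + 1) * (q + m) ≤ N * (q + m) := Nat.mul_le_mul_right _ hj
  rw [add_mul] at this
  omega

lemma blk_disj (q m N : ℕ) :
    Disjoint (blk q m N) (Finset.Ico (N * (q + m)) (N * (q + m) + q)) := by
  rw [Finset.disjoint_left]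
  intro i hi hi'
  have := blk_lt q m N i hi
  simp only [Finset.mem_Ico] at hi'
  omega

lemma blk_card (q m N : ℕ) : (blk q m N).card = N * q := by
  induction N with
  | zero => simp [blk]
  | succ N ih => rw [blk_succ, Finset.card_union_of_disjoint (blk_disj q m N), ih]; simp; ring

lemma charFun_blk (h : MDepSeq μ m X) (q N : ℕ) (s : ℝ) :
    charFun (μ.map (fun ω => ∑ i ∈ blk q m N, X i ω)) s
      = charFun (μ.map (fun ω => ∑ i ∈ Finset.range q, X i ω)) s ^ N := by
  have hm : ∀ A : Finset ℕ, Measurable (fun ω => ∑ i ∈ A, X i ω) :=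
    fun A => Finset.measurable_fun_sum _ fun i _ => h.meas i
  induction N with
  | zero => simp [blk, charFun_apply_real]
  | succ N ih =>
    have hind : IndepFun (fun ω => ∑ i ∈ blk q m N, X i ω)
        (fun ω => ∑ i ∈ Finset.Ico (N * (q + m)) (N * (q + m) + q), X i ω) μ := by
      rcases Nat.eq_zero_or_pos N with rfl | hN
      · simpa [blk] using indepFun_const_left (0 : ℝ) _
      refine h.indep_sum (N * (q + m) - m) _ _ (fun i hi => ?_) (fun i hi => ?_)
      · have := blk_lt q m N i hi
        omega
      · simp only [Finset.mem_Ico] at hi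
        have : 1 * (q + m) ≤ N * (q + m) := Nat.mul_le_mul_right _ hN
        omega
    have e : ∀ ω, ∑ i ∈ blk q m (N + 1), X i ω = ∑ i ∈ blk q m N, X i ω
        + ∑ i ∈ Finset.Ico (N * (q + m)) (N * (q + m) + q), X i ω := fun ω => by
      rw [blk_succ, Finset.sum_union (blk_disj q m N)]
    simp_rw [e]
    rw [hind.charFun_map_fun_add_eq_mul (hm _).aemeasurable (hm _).aemeasurable, Pi.mul_apply, ih,
      pow_succ]
    congr 2
    have := h.map_eq q (N * (q + m)) (fun x => ∑ i, x i) (by fun_prop)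
    have e1 : ∀ ω, ∑ i : Fin q, X i.1 ω = ∑ i ∈ Finset.range q, X i ω := fun ω =>
      Fin.sum_univ_eq_sum_range (fun i => X i ω) q
    have e2 : ∀ ω, ∑ i : Fin q, X (i.1 + N * (q + m)) ω
        = ∑ i ∈ Finset.Ico (N * (q + m)) (N * (q + m) + q), X i ω := fun ω => by
      rw [Fin.sum_univ_eq_sum_range (fun i => X (i + N * (q + m)) ω) q,
        Finset.sum_Ico_eq_sum_range]
      simp [add_comm]
    simp_rw [e1, e2] at this
    exact this

lemma charFun_diff (h : MDepSeq μ m X) (q n : ℕ) (hq : 0 < q) (hn : 0 < n) (t : ℝ) :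
    ‖charFun (μ.map (fun ω => ∑ i ∈ Finset.range n, X i ω)) ((√n)⁻¹ * t)
      - charFun (μ.map (fun ω => ∑ i ∈ Finset.range q, X i ω)) ((√n)⁻¹ * t) ^ (n / (q + m))‖
    ≤ |t| * √((m / ((q + m : ℕ) : ℝ) + (q + m : ℕ) / (n : ℝ))
        * ((2 * m + 1) * ∫ ω, X 0 ω ^ 2 ∂μ)) := by
  have hm : ∀ A : Finset ℕ, Measurable (fun ω => ∑ i ∈ A, X i ω) :=
    fun A => Finset.measurable_fun_sum _ fun i _ => h.meas i
  set N := n / (q + m) with hN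
  set C := (2 * m + 1) * ∫ ω, X 0 ω ^ 2 ∂μ with hC
  have hC0 : 0 ≤ C := mul_nonneg (by positivity) (integral_nonneg fun ω => sq_nonneg _)
  have hNL : N * (q + m) ≤ n := Nat.div_mul_le_self _ _
  have hNL' : n < N * (q + m) + (q + m) := by
    have := Nat.lt_div_mul_add (a := n) (b := q + m) (by omega)
    exact this
  have hsub : blk q m N ⊆ Finset.range n := fun i hi => by
    have := blk_lt q m N i hi
    simp only [Finset.mem_range]
    omega
  have e : ∀ ω, ∑ i ∈ Finset.range n, X i ω - ∑ i ∈ blk q m N, X i ω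
      = ∑ i ∈ Finset.range n \ blk q m N, X i ω := fun ω => by
    rw [← Finset.sum_sdiff hsub]
    ring
  rw [← h.charFun_blk]
  refine (charFun_sub_le (hm _) (hm _) ?_ _).trans ?_
  · simp_rw [e]
    exact memLp_finsetSum _ fun i _ => h.memLp i
  simp_rw [e]
  rw [abs_mul, mul_comm _ |t|, mul_assoc]
  refine mul_le_mul_of_nonneg_left ?_ (abs_nonneg t)
  have hn' : (0 : ℝ) < n := by exact_mod_cast hn
  rw [abs_of_nonneg (by positivity), ← Real.sqrt_inv, ← Real.sqrt_mul (by positivity)]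
  refine Real.sqrt_le_sqrt ?_
  refine (mul_le_mul_of_nonneg_left (h.sum_sq_le _) (by positivity)).trans ?_
  rw [← hC, ← mul_assoc]
  refine mul_le_mul_of_nonneg_right ?_ hC0
  have hcard : (Finset.range n \ blk q m N).card ≤ N * m + (q + m) := by
    rw [Finset.card_sdiff_of_subset hsub, blk_card, Finset.card_range]
    rw [mul_add] at hNL'
    omega
  have hcard' : ((Finset.range n \ blk q m N).card : ℝ) ≤ N * m + (q + m : ℕ) := by
    exact_mod_cast hcard
  have hL : (0 : ℝ) < (q + m : ℕ) := by exact_mod_cast (by omega : 0 < q + m)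
  have hNr : (N : ℝ) ≤ n / (q + m : ℕ) := Nat.cast_div_le
  have h3 : (N : ℝ) * m ≤ n / (q + m : ℕ) * m := mul_le_mul_of_nonneg_right hNr (by positivity)
  calc (n : ℝ)⁻¹ * ((Finset.range n \ blk q m N).card : ℝ)
      ≤ (n : ℝ)⁻¹ * (n / (q + m : ℕ) * m + (q + m : ℕ)) :=
        mul_le_mul_of_nonneg_left (by linarith) (by positivity)
    _ = _ := by field_simp

lemma charFun_tendsto (h : MDepSeq μ m X) (t : ℝ) :
    Tendsto (fun n : ℕ => charFun (μ.map (fun ω => ∑ i ∈ Finset.range n, X i ω)) ((√n)⁻¹ * t))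
      atTop (nhds (Complex.exp ((-(lrv μ X m * t ^ 2 / 2) : ℝ)))) := by
  have hm : ∀ A : Finset ℕ, Measurable (fun ω => ∑ i ∈ A, X i ω) :=
    fun A => Finset.measurable_fun_sum _ fun i _ => h.meas i
  set C := (2 * m + 1) * ∫ ω, X 0 ω ^ 2 ∂μ with hC
  rw [Metric.tendsto_atTop']
  intro ε hε
  have hT : Tendsto (fun q : ℕ => Complex.exp ((-(V μ X q / (q + m : ℕ) * t ^ 2 / 2) : ℝ))) atTop
      (nhds (Complex.exp ((-(lrv μ X m * t ^ 2 / 2) : ℝ)))) := by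
    refine (Continuous.tendsto (f := fun x : ℝ => Complex.exp ((-(x * t ^ 2 / 2) : ℝ)))
      (by fun_prop) _).comp h.V_tendsto
  have hH : Tendsto (fun q : ℕ => |t| * √((m / ((q + m : ℕ) : ℝ) + 0) * C)) atTop (nhds 0) := by
    have t1 : Tendsto (fun q : ℕ => (m : ℝ) / ((q + m : ℕ) : ℝ)) atTop (nhds 0) :=
      (tendsto_add_atTop_iff_nat (f := fun r : ℕ => (m : ℝ) / (r : ℝ)) m).2
        (tendsto_const_div_atTop_nhds_zero_nat _)
    have := (Continuous.tendsto (f := fun x : ℝ => |t| * √((x + 0) * C)) (by fun_prop) _).comp t1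
    simpa [Function.comp_def] using this
  obtain ⟨q, hq1, hq2, hq0⟩ := ((Metric.tendsto_nhds.1 hT (ε / 3) (by positivity)).and
    ((hH.eventually_lt_const (by positivity : 0 < ε / 3)).and (eventually_gt_atTop 0))).exists
  have hh : Tendsto (fun n : ℕ => |t| * √((m / ((q + m : ℕ) : ℝ) + (q + m : ℕ) / (n : ℝ)) * C))
      atTop (nhds (|t| * √((m / ((q + m : ℕ) : ℝ) + 0) * C))) := by
    exact (Continuous.tendsto (f := fun x : ℝ => |t| * √((m / ((q + m : ℕ) : ℝ) + x) * C))
      (by fun_prop) _).comp (tendsto_const_div_atTop_nhds_zero_nat (((q + m : ℕ) : ℝ)))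
  have hU := charFun_pow_tendsto (μ := μ) (hm (Finset.range q))
    (memLp_finsetSum _ fun i _ => h.memLp i)
    (by rw [integral_finsetSum _ fun i _ => (h.memLp i).integrable (by norm_num)]
        simp [h.mean']) (q + m) (by omega) t
  have ev := (hh.eventually_lt_const hq2).and
    ((Metric.tendsto_nhds.1 hU (ε / 3) (by positivity)).and (eventually_gt_atTop 0))
  obtain ⟨n0, hn0⟩ := eventually_atTop.1 ev
  refine ⟨n0, fun n hn => ?_⟩
  obtain ⟨h1, h2, h3⟩ := hn0 n hn.le
  have h4 := (h.charFun_diff q n hq0 h3 t).trans_lt h1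
  rw [← dist_eq_norm] at h4
  have := dist_triangle4 (charFun (μ.map (fun ω => ∑ i ∈ Finset.range n, X i ω)) ((√n)⁻¹ * t))
    (charFun (μ.map (fun ω => ∑ i ∈ Finset.range q, X i ω)) ((√n)⁻¹ * t) ^ (n / (q + m)))
    (Complex.exp ((-(V μ X q / (q + m : ℕ) * t ^ 2 / 2) : ℝ)))
    (Complex.exp ((-(lrv μ X m * t ^ 2 / 2) : ℝ)))
  have h2' : dist (charFun (μ.map (fun ω => ∑ i ∈ Finset.range q, X i ω)) ((√n)⁻¹ * t)
      ^ (n / (q + m))) (Complex.exp ((-(V μ X q / (q + m : ℕ) * t ^ 2 / 2) : ℝ))) < ε / 3 := h2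
  linarith

lemma clt (h : MDepSeq μ m X) (g : BoundedContinuousFunction ℝ ℝ) :
    Tendsto (fun n : ℕ => ∫ ω, g ((√n)⁻¹ * ∑ i ∈ Finset.range n, X i ω) ∂μ) atTop
      (nhds (∫ x, g x ∂(gaussianReal 0 (lrv μ X m).toNNReal))) := by
  have hm : ∀ n : ℕ, Measurable (fun ω => (√n)⁻¹ * ∑ i ∈ Finset.range n, X i ω) :=
    fun n => (Finset.measurable_fun_sum _ fun i _ => h.meas i).const_mul _
  let ν : ℕ → ProbabilityMeasure ℝ := fun n =>
    ⟨μ.map (fun ω => (√n)⁻¹ * ∑ i ∈ Finset.range n, X i ω),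
      Measure.isProbabilityMeasure_map (hm n).aemeasurable⟩
  let ν0 : ProbabilityMeasure ℝ := ⟨gaussianReal 0 (lrv μ X m).toNNReal, inferInstance⟩
  have key : Tendsto ν atTop (nhds ν0) := by
    refine ProbabilityMeasure.tendsto_iff_tendsto_charFun.2 fun t => ?_
    have := h.charFun_tendsto t
    have e : charFun (ν0 : Measure ℝ) t = Complex.exp ((-(lrv μ X m * t ^ 2 / 2) : ℝ)) := by
      change charFun (gaussianReal 0 (lrv μ X m).toNNReal) t = _
      rw [charFun_gaussianReal]
      congr 1
      have : (((lrv μ X m).toNNReal : ℝ) : ℂ) = (lrv μ X m : ℂ) := by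
        rw [Real.coe_toNNReal _ h.lrv_nonneg]
      rw [this]
      push_cast
      ring
    rw [e]
    refine this.congr fun n => ?_
    change _ = charFun (μ.map (fun ω => (√n)⁻¹ * ∑ i ∈ Finset.range n, X i ω)) t
    rw [charFun_map_mul_comp (Finset.measurable_fun_sum _ fun i _ => h.meas i).aemeasurable]
  have := ProbabilityMeasure.tendsto_iff_forall_integral_tendsto.1 key g
  refine this.congr fun n => ?_
  change ∫ x, g x ∂(μ.map (fun ω => (√n)⁻¹ * ∑ i ∈ Finset.range n, X i ω)) = _
  rw [integral_map (hm n).aemeasurable g.continuous.aestronglyMeasurable]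

end MDepSeq



/-- **Multivariate central limit theorem for m-dependent strictly stationary random
vectors.** If `(Z_i)_{i ≥ 1}` are strictly stationary m-dependent `ℝᵖ`-valued random
vectors with `E[Z_1] = 0` and `E[‖Z_1‖³] < ∞`, and
`Ω = E[Z_1 Z_1ᵀ] + ∑_{k=1}^m (E[Z_1 Z_{1+k}ᵀ] + E[Z_{1+k} Z_1ᵀ])`, then
`n^{-1/2} ∑_{i=1}^n Z_i` converges in distribution to `N_p(0, Ω)`; equivalently, for
every `a ∈ ℝᵖ`, `aᵀ(n^{-1/2} ∑_{i=1}^n Z_i)` converges in distribution to `N(0, aᵀΩa)`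
(weak convergence tested against bounded continuous functions; `N(0,0)` is the Dirac
mass at `0`). -/
theorem stmt_18 {Ω : Type*} [MeasurableSpace Ω] (μ : Measure Ω) [IsProbabilityMeasure μ]
    (p : ℕ) (m : ℕ) (Z : ℕ → Ω → Fin p → ℝ) (hmeas : ∀ i, Measurable (Z i))
    -- strict stationarity : (Z_1, …, Z_k) and (Z_{1+j}, …, Z_{k+j}) have the same law
    (hstat : ∀ (k j : ℕ),
      Measure.map (fun ω => fun i : Fin k => Z (i.1 + 1) ω) μ
        = Measure.map (fun ω => fun i : Fin k => Z (i.1 + 1 + j) ω) μ)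
    -- m-dependence : (Z_1, …, Z_k) is independent of (Z_{k+m+1}, Z_{k+m+2}, …)
    (hdep : ∀ k : ℕ, 1 ≤ k →
      Indep (⨆ i : Fin k, MeasurableSpace.comap (Z (i.1 + 1)) inferInstance)
        (⨆ i : ℕ, MeasurableSpace.comap (Z (k + m + 1 + i)) inferInstance) μ)
    (hmean : ∀ j : Fin p, ∫ ω, Z 1 ω j ∂μ = 0)
    -- `E[‖Z_1‖³] < ∞` for the Euclidean norm
    (hL3 : Integrable (fun ω => (Real.sqrt (∑ j : Fin p, (Z 1 ω j) ^ 2)) ^ 3) μ)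
    -- the limiting covariance matrix Ω
    (Omat : Matrix (Fin p) (Fin p) ℝ)
    (hOmat : ∀ j k : Fin p, Omat j k
      = (∫ ω, Z 1 ω j * Z 1 ω k ∂μ)
        + ∑ k' ∈ Finset.range m,
            ((∫ ω, Z 1 ω j * Z (k' + 2) ω k ∂μ)
              + (∫ ω, Z (k' + 2) ω j * Z 1 ω k ∂μ))) :
    ∀ a : Fin p → ℝ,
      ∀ g : BoundedContinuousFunction ℝ ℝ,
        Tendsto (fun n : ℕ =>
            ∫ ω, g (∑ j : Fin p, a j * ((Real.sqrt n)⁻¹ * ∑ i ∈ Finset.Icc 1 n, Z i ω j)) ∂μ)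
          atTop
          (nhds (∫ x, g x
            ∂(gaussianReal 0 (∑ j : Fin p, ∑ k : Fin p, a j * Omat j k * a k).toNNReal))) := by
  intro a g
  have hm1 : ∀ i j, Measurable (fun ω => Z i ω j) := fun i j => (measurable_pi_apply j).comp (hmeas i)
  -- square integrability
  have hZ1 : ∀ j, MemLp (fun ω => Z 1 ω j) 2 μ := by
    intro j
    have h3 : MemLp (fun ω => Real.sqrt (∑ j : Fin p, (Z 1 ω j) ^ 2)) 3 μ := by
      have hmm : Measurable (fun ω => Real.sqrt (∑ j : Fin p, (Z 1 ω j) ^ 2)) :=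
        (Finset.measurable_fun_sum _ fun j _ => (hm1 1 j).pow_const 2).sqrt
      rw [← integrable_norm_rpow_iff hmm.aestronglyMeasurable (by norm_num) (by norm_num)]
      refine hL3.congr (ae_of_all _ fun ω => ?_)
      simp [abs_of_nonneg (Real.sqrt_nonneg _)]
    have h2 : MemLp (fun ω => Real.sqrt (∑ j : Fin p, (Z 1 ω j) ^ 2)) 2 μ :=
      h3.mono_exponent (by norm_num)
    refine h2.mono (hm1 1 j).aestronglyMeasurable (ae_of_all _ fun ω => ?_)
    rw [Real.norm_eq_abs, Real.norm_eq_abs, abs_of_nonneg (Real.sqrt_nonneg _)]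
    refine Real.abs_le_sqrt ?_
    exact Finset.single_le_sum (f := fun j => Z 1 ω j ^ 2) (fun j _ => sq_nonneg _)
      (Finset.mem_univ j)
  have hZ : ∀ i j, MemLp (fun ω => Z (i + 1) ω j) 2 μ := by
    intro i j
    have hid : IdentDistrib (fun ω => Z (i + 1) ω j) (fun ω => Z 1 ω j) μ μ := by
      refine ⟨(hm1 _ _).aemeasurable, (hm1 _ _).aemeasurable, ?_⟩
      have h1 := hstat 1 i
      have hF : Measurable (fun x : Fin 1 → Fin p → ℝ => x 0 j) := by fun_prop
      have e1 := Measure.map_map (μ := μ) hF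
        (measurable_pi_lambda (fun ω => fun i : Fin 1 => Z (i.1 + 1) ω) fun _ => hmeas _)
      have e2 := Measure.map_map (μ := μ) hF
        (measurable_pi_lambda (fun ω => fun k : Fin 1 => Z (k.1 + 1 + i) ω) fun _ => hmeas _)
      rw [← h1, e1] at e2
      simpa [Function.comp_def, add_comm] using e2.symm
    exact hid.memLp_iff.2 (hZ1 j)
  -- the scalar sequence
  let φ : (Fin p → ℝ) → ℝ := fun z => ∑ j, a j * z j
  have hφ : Measurable φ := by fun_prop
  let X : ℕ → Ω → ℝ := fun i ω => φ (Z (i + 1) ω)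
  have hcomap : ∀ i, MeasurableSpace.comap (X i) inferInstance
      ≤ MeasurableSpace.comap (Z (i + 1)) inferInstance := by
    intro i
    rw [← measurable_iff_comap_le]
    exact hφ.comp (comap_measurable (Z (i + 1)))
  have hX : MDepSeq μ m X := by
    refine ⟨fun i => hφ.comp (hmeas _), fun k j => ?_, fun k => ?_, ?_, ?_⟩
    · have hF : Measurable (fun (x : Fin k → Fin p → ℝ) (i : Fin k) => φ (x i)) :=
        measurable_pi_lambda _ fun i => hφ.comp (measurable_pi_apply i)
      have e1 := Measure.map_map (μ := μ) hF
        (measurable_pi_lambda (fun ω => fun i : Fin k => Z (i.1 + 1) ω) fun _ => hmeas _)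
      have e2 := Measure.map_map (μ := μ) hF
        (measurable_pi_lambda (fun ω => fun i : Fin k => Z (i.1 + 1 + j) ω) fun _ => hmeas _)
      rw [← hstat k j, e1] at e2
      refine e2.trans ?_
      congr 1
      ext ω i
      simp only [Function.comp, X]
      congr 2
      omega
    · rcases Nat.eq_zero_or_pos k with rfl | hk
      · rw [iSup_of_empty]
        exact indep_bot_left _
      · refine indep_of_indep_of_le (hdep k hk) ?_ ?_
        · exact iSup_mono fun i => hcomap i.1
        · refine iSup_mono fun i => ?_
          have := hcomap (k + m + i)
          rwa [show k + m + i + 1 = k + m + 1 + i by omega] at this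
    · change ∫ ω, ∑ j, a j * Z (0 + 1) ω j ∂μ = 0
      rw [integral_finsetSum _ fun j _ => ((hZ 0 j).integrable (by norm_num)).const_mul _]
      simp [integral_const_mul, hmean]
    · exact memLp_finsetSum _ fun j _ => (hZ 0 j).const_mul (a j)
  have hcov : ∀ i i' : ℕ, ∫ ω, X i ω * X i' ω ∂μ
      = ∑ j, ∑ k, a j * (∫ ω, Z (i + 1) ω j * Z (i' + 1) ω k ∂μ) * a k := by
    intro i i'
    have hint : ∀ j k, Integrable (fun ω => a j * Z (i + 1) ω j * (a k * Z (i' + 1) ω k)) μ :=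
      fun j k => ((hZ i j).const_mul (a j)).integrable_mul ((hZ i' k).const_mul (a k))
    have e : ∀ ω, X i ω * X i' ω
        = ∑ j, ∑ k, a j * Z (i + 1) ω j * (a k * Z (i' + 1) ω k) := fun ω => by
      simp only [X, φ, Finset.sum_mul_sum]
    simp_rw [e]
    rw [integral_finsetSum _ fun j _ => integrable_finsetSum _ fun k _ => hint j k]
    refine Finset.sum_congr rfl fun j _ => ?_
    rw [integral_finsetSum _ fun k _ => hint j k]
    refine Finset.sum_congr rfl fun k _ => ?_
    rw [← integral_const_mul, ← integral_mul_const]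
    congr 1
    ext ω
    ring
  have hv : ∑ j : Fin p, ∑ k : Fin p, a j * Omat j k * a k = MDepSeq.lrv μ X m := by
    have e1 : MDepSeq.lrv μ X m = (∫ ω, X 0 ω * X 0 ω ∂μ)
        + ∑ k ∈ Finset.range m, ((∫ ω, X 0 ω * X (k + 1) ω ∂μ)
          + ∫ ω, X (k + 1) ω * X 0 ω ∂μ) := by
      unfold MDepSeq.lrv
      rw [Finset.mul_sum]
      congr 1
      refine Finset.sum_congr rfl fun k _ => ?_
      simp_rw [mul_comm (X (k + 1) _)]
      ring
    rw [e1]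
    simp_rw [hcov, hOmat, ← Finset.sum_add_distrib]
    rw [Finset.sum_comm (s := Finset.range m), ← Finset.sum_add_distrib]
    refine Finset.sum_congr rfl fun j _ => ?_
    rw [Finset.sum_comm (s := Finset.range m), ← Finset.sum_add_distrib]
    refine Finset.sum_congr rfl fun k _ => ?_
    rw [mul_add, add_mul, Finset.mul_sum, Finset.sum_mul]
    congr 1
    refine Finset.sum_congr rfl fun k' _ => ?_
    simp only [zero_add, add_assoc, Nat.reduceAdd]
    ring
  rw [hv]
  refine (hX.clt g).congr fun n => ?_
  congr 1
  ext ω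
  congr 1
  simp only [X, φ]
  rw [Finset.sum_comm, Finset.mul_sum]
  refine Finset.sum_congr rfl fun j _ => ?_
  rw [← Finset.mul_sum]
  have e : ∑ i ∈ Finset.Icc 1 n, Z i ω j = ∑ i ∈ Finset.range n, Z (i + 1) ω j := by
    rw [Finset.range_eq_Ico, Finset.sum_Ico_add' (fun i => Z i ω j) 0 n 1]
    congr 1
  rw [e]
  ring
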